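/- Let n be an even positive integer. In the polynomial ring R = MvPolynomial (Fin n × Fin n) ℂ, let det X = ∑_{σ ∈ Perm(Fin n)} sgn(σ) ∏_i X_{i,σ(i)} and let D : R → R be the linear operator D = ∑_{σ ∈ Perm(Fin n)} ∏_{i} ∂/∂X_{i,σ(i)}, and let ∂_Π : R → R be the composition of the partial derivatives ∂/∂X_{ij} over all pairs (i,j) ∈ Fin n × Fin n. Then D^n((det X)^n) ≠ 0 if and only if ∂_Π((det X)^n) ≠ 0 (equivalently, if and only if the coefficient of the monomial ∏_{(i,j)} X_{ij} in (det X)^n is nonzero). -/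

import Mathlib

namespace AlonTarsi

/-- The determinant of the generic n × n matrix of variables X_{ij}, over ℂ. -/
noncomputable def genericDetC (n : ℕ) : MvPolynomial (Fin n × Fin n) ℂ :=
  Matrix.det (Matrix.of fun i j : Fin n => (MvPolynomial.X (i, j) : MvPolynomial (Fin n × Fin n) ℂ))

/-- The differential operator D = ∑_{σ ∈ Perm(Fin n)} ∏_i ∂/∂X_{i,σ(i)}: the permanent of
the matrix of partial derivative operators (the partial derivatives commute, so the order
of composition within each product is immaterial). -/
noncomputable def permDerivOp (n : ℕ) : Module.End ℂ (MvPolynomial (Fin n × Fin n) ℂ) :=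
  ∑ σ : Equiv.Perm (Fin n),
    (List.ofFn fun i : Fin n =>
      ((MvPolynomial.pderiv (i, σ i)).toLinearMap :
        Module.End ℂ (MvPolynomial (Fin n × Fin n) ℂ))).prod

/-- The composition ∂_Π of the partial derivatives ∂/∂X_{ij} over all pairs (i, j); the
partial derivatives commute, so the order of composition is immaterial. -/
noncomputable def allDerivOp (n : ℕ) : Module.End ℂ (MvPolynomial (Fin n × Fin n) ℂ) :=
  ((Finset.univ : Finset (Fin n × Fin n)).toList.map fun p =>
    ((MvPolynomial.pderiv p).toLinearMap :
      Module.End ℂ (MvPolynomial (Fin n × Fin n) ℂ))).prod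

open MvPolynomial

section ConstantCoefficientDifferentialOperators

variable {σ K : Type*} [Field K]

theorem pderiv_comm_apply (p q : σ) (g : MvPolynomial σ K) :
    pderiv p (pderiv q g) = pderiv q (pderiv p g) := by
  classical
  ext m
  simp only [coeff_pderiv, Finsupp.add_apply, add_right_comm m]
  by_cases h : p = q
  · subst h; rfl
  · simp [h, Ne.symm h]
    ring

/-- The partial derivatives, as linear endomorphisms of the polynomial ring. -/
noncomputable def pderivEnd (p : σ) : Module.End K (MvPolynomial σ K) :=
  (pderiv p).toLinearMap

theorem commute_pderivEnd :
    ∀ a ∈ Set.range (pderivEnd (σ := σ) (K := K)), ∀ b ∈ Set.range (pderivEnd (σ := σ) (K := K)),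
      a * b = b * a := by
  rintro _ ⟨p, rfl⟩ _ ⟨q, rfl⟩
  exact LinearMap.ext fun g => pderiv_comm_apply p q g

open scoped IsMulCommutative in
/-- The differential operator `f(∂)` attached to a polynomial `f`. -/
noncomputable def diffOp : MvPolynomial σ K →ₐ[K] Module.End K (MvPolynomial σ K) :=
  haveI : IsMulCommutative (Algebra.adjoin K (Set.range (pderivEnd (σ := σ) (K := K)))) :=
    Algebra.isMulCommutative_adjoin K commute_pderivEnd
  (Algebra.adjoin K (Set.range (pderivEnd (σ := σ) (K := K)))).val.comp
    (aeval fun p => ⟨pderivEnd p, Algebra.subset_adjoin ⟨p, rfl⟩⟩)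

theorem diffOp_X (p : σ) : diffOp (X p : MvPolynomial σ K) = (pderiv p).toLinearMap := by
  simp [diffOp, pderivEnd]

theorem diffOp_X_apply (p : σ) (g : MvPolynomial σ K) : diffOp (X p) g = pderiv p g := by
  rw [diffOp_X]; rfl

theorem diffOp_C_apply (a : K) (g : MvPolynomial σ K) : diffOp (C a) g = C a * g := by
  rw [← algebraMap_eq, AlgHom.commutes, Module.algebraMap_end_apply, Algebra.smul_def]

theorem diffOp_mul_apply (f h g : MvPolynomial σ K) :
    diffOp (f * h) g = diffOp f (diffOp h g) := by
  rw [map_mul, Module.End.mul_apply]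

theorem coeff_diffOp_monomial [CharZero K] (m : σ →₀ ℕ) :
    ∀ e : σ →₀ ℕ, ∃ r : K, r ≠ 0 ∧
      ∀ g, coeff e (diffOp (monomial m 1) g) = r * coeff (e + m) g := by
  have hadd (a b : σ →₀ ℕ)
      (ha : ∀ e : σ →₀ ℕ, ∃ r : K, r ≠ 0 ∧
        ∀ g, coeff e (diffOp (monomial a 1) g) = r * coeff (e + a) g)
      (hb : ∀ e : σ →₀ ℕ, ∃ r : K, r ≠ 0 ∧
        ∀ g, coeff e (diffOp (monomial b 1) g) = r * coeff (e + b) g) (e : σ →₀ ℕ) :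
      ∃ r : K, r ≠ 0 ∧
        ∀ g, coeff e (diffOp (monomial (a + b) 1) g) = r * coeff (e + (a + b)) g := by
    obtain ⟨r, hr, hra⟩ := ha e
    obtain ⟨s, hs, hsb⟩ := hb (e + a)
    refine ⟨r * s, mul_ne_zero hr hs, fun g => ?_⟩
    have : (monomial (a + b) (1 : K)) = monomial a 1 * monomial b 1 := by simp
    rw [this, diffOp_mul_apply, hra, hsb, mul_assoc, add_assoc]
  have hzero (e : σ →₀ ℕ) : ∃ r : K, r ≠ 0 ∧
      ∀ g, coeff e (diffOp (monomial 0 1) g) = r * coeff (e + 0) g :=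
    ⟨1, one_ne_zero, fun g => by
      rw [show (monomial 0 (1 : K) : MvPolynomial σ K) = 1 from rfl, map_one]; simp⟩
  induction m using Finsupp.induction_linear with
  | zero => exact hzero
  | add a b ha hb => exact hadd a b ha hb
  | single p k =>
    induction k with
    | zero => simpa using hzero
    | succ k ih =>
      rw [Finsupp.single_add]
      refine hadd _ _ ih fun e => ⟨e p + 1, Nat.cast_add_one_ne_zero _, fun g => ?_⟩
      change coeff e (diffOp (X p) g) = _
      rw [diffOp_X_apply, coeff_pderiv, mul_comm]

theorem diffOp_apply_eq_C [CharZero K] {N : ℕ} {f g : MvPolynomial σ K}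
    (hf : f.IsHomogeneous N) (hg : g.IsHomogeneous N) :
    diffOp f g = C (constantCoeff (diffOp f g)) := by
  classical
  ext e
  rw [coeff_C, constantCoeff_eq]
  split_ifs with he
  · rw [he]
  · conv_lhs => rw [f.as_sum]
    rw [map_sum, LinearMap.sum_apply, coeff_sum]
    refine Finset.sum_eq_zero fun m hm => ?_
    obtain ⟨r, -, hr⟩ := coeff_diffOp_monomial (K := K) m e
    have hmon : monomial m (coeff m f) = coeff m f • monomial m (1 : K) := by
      simp [smul_monomial]
    rw [hmon, map_smul, LinearMap.smul_apply, coeff_smul, hr, hg.coeff_eq_zero, mul_zero, smul_zero]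
    have hdeg : m.degree = N := by
      by_contra h
      exact mem_support_iff.mp hm (hf.coeff_eq_zero h)
    have : e.degree ≠ 0 := fun h => he ((Finsupp.degree_eq_zero_iff e).mp h).symm
    rw [map_add]
    omega

end ConstantCoefficientDifferentialOperators

section LinearSubstitution

variable {ι κ K : Type*} [Fintype ι] [Field K]

/-- The substitution `X ↦ A * X` of the generic matrix. -/
noncomputable def mulSubst (A : Matrix ι ι K) :
    MvPolynomial (ι × κ) K →ₐ[K] MvPolynomial (ι × κ) K :=
  aeval fun p => ∑ k, C (A p.1 k) * X (k, p.2)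

theorem mulSubst_X (A : Matrix ι ι K) (p : ι × κ) :
    mulSubst A (X p) = ∑ k, C (A p.1 k) * X (k, p.2) := by
  simp [mulSubst]

theorem constantCoeff_mulSubst (A : Matrix ι ι K) (g : MvPolynomial (ι × κ) K) :
    constantCoeff (mulSubst A g) = constantCoeff g := by
  induction g using MvPolynomial.induction_on with
  | C a => simp [mulSubst]
  | add f g hf hg => simp [hf, hg]
  | mul_X f p hf => simp [hf, mulSubst_X]

theorem pderiv_mulSubst_transpose (A : Matrix ι ι K) (p : ι × κ) (g : MvPolynomial (ι × κ) K) :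
    pderiv p (mulSubst A.transpose g) =
      mulSubst A.transpose (∑ k, C (A p.1 k) * pderiv (k, p.2) g) := by
  classical
  induction g using MvPolynomial.induction_on with
  | C a => simp [mulSubst]
  | add f g hf hg => simp only [map_add, hf, hg, mul_add, Finset.sum_add_distrib]
  | mul_X f q hf =>
    have hX : pderiv p (mulSubst A.transpose (X q)) =
        mulSubst A.transpose (∑ k, C (A p.1 k) * pderiv (k, p.2) (X q)) := by
      obtain ⟨i, j⟩ := p
      obtain ⟨k, l⟩ := q
      simp only [mulSubst_X, map_sum, map_mul, Derivation.leibniz, pderiv_C, pderiv_X,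
        Pi.single_apply, Prod.mk.injEq, smul_eq_mul, mul_zero, add_zero, Matrix.transpose_apply]
      by_cases hjl : j = l <;> simp [hjl, eq_comm, mulSubst]
    have hmul : ∑ k, C (A p.1 k) * pderiv (k, p.2) (f * X q) =
        f * ∑ k, C (A p.1 k) * pderiv (k, p.2) (X q) +
          X q * ∑ k, C (A p.1 k) * pderiv (k, p.2) f := by
      simp only [Derivation.leibniz, smul_eq_mul, mul_add, Finset.sum_add_distrib, Finset.mul_sum,
        mul_left_comm]
    rw [hmul, map_mul, Derivation.leibniz, hf, hX, smul_eq_mul, smul_eq_mul, map_add, map_mul,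
      map_mul]

theorem diffOp_mulSubst_transpose (A : Matrix ι ι K) (f g : MvPolynomial (ι × κ) K) :
    diffOp f (mulSubst A.transpose g) = mulSubst A.transpose (diffOp (mulSubst A f) g) := by
  induction f using MvPolynomial.induction_on generalizing g with
  | C a =>
    have h : mulSubst A (C a : MvPolynomial (ι × κ) K) = C a := algHom_C _ a
    have h' : mulSubst A.transpose (C a : MvPolynomial (ι × κ) K) = C a := algHom_C _ a
    rw [h, diffOp_C_apply, diffOp_C_apply, map_mul, h']
  | add f h hf hh => simp only [map_add, LinearMap.add_apply, hf, hh]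
  | mul_X f p hf =>
    rw [diffOp_mul_apply, diffOp_X_apply, pderiv_mulSubst_transpose, hf, map_mul,
      diffOp_mul_apply, mulSubst_X]
    simp only [map_sum, LinearMap.sum_apply, diffOp_mul_apply, diffOp_C_apply, diffOp_X_apply]

end LinearSubstitution

theorem mulSubst_genericDetC {n : ℕ} (A : Matrix (Fin n) (Fin n) ℂ) :
    mulSubst A (genericDetC n) = C A.det * genericDetC n := by
  rw [genericDetC, AlgHom.map_det, RingHom.map_det, ← Matrix.det_mul]
  congr 1
  ext1 i j
  simp [Matrix.mul_apply, mulSubst_X]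

theorem isHomogeneous_genericDetC (n : ℕ) : (genericDetC n).IsHomogeneous n := by
  rw [genericDetC, Matrix.det_apply]
  refine IsHomogeneous.sum _ _ _ fun τ _ => ?_
  have h : (∏ i, (X (τ i, i) : MvPolynomial (Fin n × Fin n) ℂ)).IsHomogeneous n := by
    simpa using IsHomogeneous.prod Finset.univ
      (fun i => (X (τ i, i) : MvPolynomial (Fin n × Fin n) ℂ)) (fun _ => 1)
      fun i _ => isHomogeneous_X ℂ _
  rcases Int.units_eq_one_or (Equiv.Perm.sign τ) with hs | hs
  · simpa [hs] using h
  · simpa [hs] using h.neg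

/-- The permanent of the generic matrix. -/
noncomputable def genericPerm (n : ℕ) : MvPolynomial (Fin n × Fin n) ℂ :=
  ∑ τ : Equiv.Perm (Fin n), ∏ i, X (i, τ i)

theorem isHomogeneous_genericPerm (n : ℕ) : (genericPerm n).IsHomogeneous n := by
  refine IsHomogeneous.sum _ _ _ fun τ _ => ?_
  simpa using IsHomogeneous.prod Finset.univ
    (fun i => (X (i, τ i) : MvPolynomial (Fin n × Fin n) ℂ)) (fun _ => 1)
    fun i _ => isHomogeneous_X ℂ _

theorem permDerivOp_eq_diffOp (n : ℕ) : permDerivOp n = diffOp (genericPerm n) := by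
  simp only [permDerivOp, genericPerm, map_sum, ← List.prod_ofFn, map_list_prod, List.map_ofFn,
    Function.comp_def, diffOp_X]

theorem allDerivOp_eq_diffOp (n : ℕ) :
    allDerivOp n = diffOp (∏ p : Fin n × Fin n, X p) := by
  rw [allDerivOp, ← Finset.prod_map_toList, map_list_prod, List.map_map]
  simp only [Function.comp_def, diffOp_X]

theorem genericPerm_pow (n : ℕ) :
    genericPerm n ^ n =
      ∑ s : Fin n → Equiv.Perm (Fin n), ∏ p : Fin n × Fin n, X (s p.1 p.2, p.2) := by
  have h : genericPerm n = ∑ τ : Equiv.Perm (Fin n), ∏ j, X (τ j, j) := by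
    rw [genericPerm, ← Equiv.sum_comp (Equiv.inv (Equiv.Perm (Fin n)))]
    refine Finset.sum_congr rfl fun τ _ => ?_
    rw [← Equiv.prod_comp τ]
    simp
  rw [h]
  simp_rw [Fintype.prod_prod_type]
  simpa using Finset.prod_univ_sum (fun _ : Fin n => (Finset.univ : Finset (Equiv.Perm (Fin n))))
    fun _ τ => ∏ j, (X (τ j, j) : MvPolynomial (Fin n × Fin n) ℂ)

theorem prod_X_eq_monomial {α σ R : Type*} [CommSemiring R] (s : Finset α) (v : α → σ) :
    ∏ a ∈ s, (X (v a) : MvPolynomial σ R) = monomial (∑ a ∈ s, Finsupp.single (v a) 1) 1 := by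
  rw [monomial_sum_one]; rfl

theorem constantCoeff_diffOp_prod_X_ne_zero_iff {σ K : Type*} [Fintype σ] [Field K] [CharZero K]
    (g : MvPolynomial σ K) :
    constantCoeff (diffOp (∏ p, X p) g) ≠ 0 ↔ coeff (∑ p, Finsupp.single p 1) g ≠ 0 := by
  obtain ⟨r, hr, h⟩ := coeff_diffOp_monomial (K := K) (∑ p : σ, Finsupp.single p 1) 0
  rw [prod_X_eq_monomial, constantCoeff_eq, h, zero_add]
  simp [hr]

theorem constantCoeff_diffOp_mulSubst {n : ℕ} (A : Matrix (Fin n) (Fin n) ℂ)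
    (f : MvPolynomial (Fin n × Fin n) ℂ) (k : ℕ) :
    constantCoeff (diffOp (mulSubst A f) (genericDetC n ^ k)) =
      A.det ^ k * constantCoeff (diffOp f (genericDetC n ^ k)) := by
  rw [← constantCoeff_mulSubst A.transpose, ← diffOp_mulSubst_transpose, map_pow,
    mulSubst_genericDetC, mul_pow, ← map_pow, C_mul', map_smul, Matrix.det_transpose]
  simp

theorem sum_constantCoeff_diffOp_mul_prod_X (n k : ℕ) :
    ∑ κ : Fin n × Fin n → Fin n,
        C (constantCoeff (diffOp (∏ p, X (κ p, p.2)) (genericDetC n ^ k))) *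
          ∏ p : Fin n × Fin n, X (p.1, κ p) =
      C (constantCoeff (diffOp (∏ p, X p) (genericDetC n ^ k))) * genericDetC n ^ k := by
  refine MvPolynomial.funext fun a => ?_
  have h := constantCoeff_diffOp_mulSubst (Matrix.of fun i j => a (i, j)) (∏ p, X p) k
  have hdet : eval a (genericDetC n) = (Matrix.of fun i j => a (i, j)).det := by
    rw [genericDetC, RingHom.map_det]
    congr 1
    ext1 i j
    simp
  simp only [map_mul, map_pow, hdet, eval_C, map_sum, map_prod, eval_X]
  rw [mul_comm, ← h, map_prod]
  simp only [mulSubst_X]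
  rw [Finset.prod_univ_sum, Fintype.piFinset_univ]
  simp only [Finset.prod_mul_distrib, ← map_prod, C_mul', map_sum, map_smul, LinearMap.sum_apply,
    LinearMap.smul_apply, Matrix.of_apply, constantCoeff_smul, smul_eq_mul, mul_comm]

theorem coeff_prod_X_graph_perm {n : ℕ} (s : Fin n → Equiv.Perm (Fin n)) :
    coeff (∑ p : Fin n × Fin n, Finsupp.single p 1)
      (∏ p : Fin n × Fin n, (X (p.1, s p.1 p.2) : MvPolynomial (Fin n × Fin n) ℂ)) = 1 := by
  have h : ∏ p : Fin n × Fin n, (X (p.1, s p.1 p.2) : MvPolynomial (Fin n × Fin n) ℂ) =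
      ∏ p, X p := by
    simp_rw [Fintype.prod_prod_type]
    exact Finset.prod_congr rfl fun i _ => Equiv.prod_comp (s i) fun j => X (i, j)
  rw [h, prod_X_eq_monomial, coeff_monomial, if_pos rfl]

theorem exists_perm_of_coeff_prod_X_graph_ne_zero {n : ℕ} (κ : Fin n × Fin n → Fin n)
    (h : coeff (∑ p : Fin n × Fin n, Finsupp.single p 1)
      (∏ p : Fin n × Fin n, (X (p.1, κ p) : MvPolynomial (Fin n × Fin n) ℂ)) ≠ 0) :
    ∃ s : Fin n → Equiv.Perm (Fin n), (fun p => s p.1 p.2) = κ := by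
  rw [prod_X_eq_monomial, coeff_monomial, ne_eq, ite_eq_right_iff, not_forall] at h
  obtain ⟨h, -⟩ := h
  have hsurj (i : Fin n) : Function.Surjective fun j => κ (i, j) := by
    intro l
    have hl := DFunLike.congr_fun h (i, l)
    simp only [Finsupp.finsetSum_apply, Finsupp.single_apply, Finset.sum_ite_eq',
      Finset.mem_univ, if_true] at hl
    obtain ⟨⟨i', j⟩, -, hp⟩ := Finset.exists_ne_zero_of_sum_ne_zero (hl ▸ one_ne_zero)
    simp only [Prod.mk.injEq, ne_eq, ite_eq_right_iff, one_ne_zero, imp_false, not_not] at hp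
    obtain ⟨rfl, hj⟩ := hp
    exact ⟨j, hj⟩
  exact ⟨fun i => Equiv.ofBijective _ (Finite.surjective_iff_bijective.mp (hsurj i)), rfl⟩

theorem constantCoeff_diffOp_genericPerm_pow (n : ℕ) :
    constantCoeff (diffOp (genericPerm n ^ n) (genericDetC n ^ n)) =
      constantCoeff (diffOp (∏ p, X p) (genericDetC n ^ n)) *
        coeff (∑ p : Fin n × Fin n, Finsupp.single p 1) (genericDetC n ^ n) := by
  have h := congrArg (coeff (∑ p : Fin n × Fin n, Finsupp.single p 1))
    (sum_constantCoeff_diffOp_mul_prod_X n n)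
  rw [coeff_C_mul, coeff_sum] at h
  rw [← h, genericPerm_pow, map_sum, LinearMap.sum_apply, map_sum]
  refine Finset.sum_of_injOn (fun s p => s p.1 p.2) ?_ (by simp) ?_ ?_
  · intro s _ t _ hst
    ext i j
    exact congrArg Fin.val (congrFun hst (i, j))
  · intro κ _ hκ
    rw [coeff_C_mul]
    by_contra hne
    obtain ⟨s, hs⟩ := exists_perm_of_coeff_prod_X_graph_ne_zero κ (right_ne_zero_of_mul hne)
    exact hκ ⟨s, by simp, hs⟩
  · intro s _
    rw [coeff_C_mul, coeff_prod_X_graph_perm, mul_one]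

/-- For n even, D^n((det X)^n) ≠ 0 iff ∂_Π((det X)^n) ≠ 0, equivalently iff the coefficient
of the multilinear monomial ∏_{(i,j)} X_{ij} in (det X)^n is nonzero. -/
theorem permDerivOp_pow_ne_zero_iff_allDerivOp_ne_zero (n : ℕ) (hn : 0 < n) (hev : Even n) :
    ((permDerivOp n ^ n) ((genericDetC n) ^ n) ≠ 0 ↔
        allDerivOp n ((genericDetC n) ^ n) ≠ 0) ∧
      (allDerivOp n ((genericDetC n) ^ n) ≠ 0 ↔
        MvPolynomial.coeff (∑ p : Fin n × Fin n, Finsupp.single p 1) ((genericDetC n) ^ n) ≠ 0) := by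
  have hdet : (genericDetC n ^ n).IsHomogeneous (n * n) := (isHomogeneous_genericDetC n).pow n
  have hprod : (∏ p : Fin n × Fin n, (X p : MvPolynomial _ ℂ)).IsHomogeneous (n * n) := by
    simpa using IsHomogeneous.prod Finset.univ
      (fun p : Fin n × Fin n => (X p : MvPolynomial _ ℂ)) (fun _ => 1)
      fun p _ => isHomogeneous_X ℂ p
  have hall : allDerivOp n (genericDetC n ^ n) ≠ 0 ↔
      coeff (∑ p : Fin n × Fin n, Finsupp.single p 1) (genericDetC n ^ n) ≠ 0 := by
    rw [allDerivOp_eq_diffOp, diffOp_apply_eq_C hprod hdet, Ne, C_eq_zero]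
    exact constantCoeff_diffOp_prod_X_ne_zero_iff _
  refine ⟨?_, hall⟩
  rw [hall, permDerivOp_eq_diffOp, ← map_pow,
    diffOp_apply_eq_C ((isHomogeneous_genericPerm n).pow n) hdet, Ne, C_eq_zero,
    constantCoeff_diffOp_genericPerm_pow, mul_eq_zero, not_or,
    ← ne_eq (constantCoeff _), constantCoeff_diffOp_prod_X_ne_zero_iff, ne_eq, and_self]

end AlonTarsi
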